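/- arXiv:1809.05631 — 2 statements merged into one kernel-verified Lean document; each statement's English description precedes it below -/
import Mathlib

section
/- Assume I_{ε,r} < −1 and let K₀ = max{1, 2(9+ε)/r}. Then the probability that there exists a vertex v of 𝔾(n,p₂,p₃) whose propagation component satisfies |C_v| ≥ K₀·ln n tends to 0 as n → ∞; in particular, with high probability every propagation component of 𝔾(n,p₂,p₃) has fewer than K₀·ln n vertices. -/
open MeasureTheory Real Filter

/-- Bernoulli-type measure on `Bool` with success probability `p`. -/
noncomputable def bern (p : ℝ) : Measure Bool :=
  (ENNReal.ofReal p) • Measure.dirac true + (ENNReal.ofReal (1 - p)) • Measure.dirac false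

instance bern_finite (p : ℝ) : IsFiniteMeasure (bern p) := by
  constructor
  simp only [bern, Measure.coe_add, Measure.coe_smul, Pi.add_apply, Pi.smul_apply,
    smul_eq_mul]
  finiteness

/-- Index type of potential edges: subsets of size 2 or 3. -/
abbrev EdgeIdx (n : ℕ) := {e : Finset (Fin n) // e.card = 2 ∨ e.card = 3}

/-- The law of the random hypergraph `𝔾(n, p₂, p₃)` with `p₂ = (1-ε)/n` and
`p₃ = r/(n ln n)`: the product of Bernoulli measures over all 2- and 3-subsets. -/
noncomputable def hypMeasure (n : ℕ) (ε r : ℝ) : Measure (EdgeIdx n → Bool) :=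
  Measure.pi fun e =>
    bern (if e.1.card = 2 then (1 - ε) / n else r / (n * Real.log n))

/-- `e` is an edge of the configuration `ω`. -/
def IsEdge {n : ℕ} (ω : EdgeIdx n → Bool) (e : Finset (Fin n)) : Prop :=
  ∃ h : e.card = 2 ∨ e.card = 3, ω ⟨e, h⟩ = true

/-- The constant `I_{ε,r} = -(1/r)(ε - ε²/2 + (1-ε)ln(1-ε))`. -/
noncomputable def Ier (ε r : ℝ) : ℝ :=
  -(1 / r) * (ε - ε ^ 2 / 2 + (1 - ε) * Real.log (1 - ε))

/-- The constant `K₀ = max {1, 2(9+ε)/r}`. -/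
noncomputable def K0 (ε r : ℝ) : ℝ := max 1 (2 * (9 + ε) / r)

/-- `f 0, …, f (k-1)` is a propagation sequence from the vertex set `S`:
every `f l` is an edge and meets `S ∪ f 0 ∪ ⋯ ∪ f (l-1)` in all but exactly
one vertex. -/
def IsPropSeqFrom {n : ℕ} (ω : EdgeIdx n → Bool) (S : Finset (Fin n))
    (k : ℕ) (f : ℕ → Finset (Fin n)) : Prop :=
  (∀ i < k, IsEdge ω (f i)) ∧
  ∀ l < k, (f l ∩ (S ∪ (Finset.range l).biUnion f)).card = (f l).card - 1

/-- The propagation component of the vertex set `S`: the union of `S` with all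
edges occurring in propagation sequences from `S`. -/
def propComponent {n : ℕ} (ω : EdgeIdx n → Bool) (S : Finset (Fin n)) : Set (Fin n) :=
  ↑S ∪ {x | ∃ k f, IsPropSeqFrom ω S k f ∧ ∃ i < k, x ∈ f i}

lemma bern_singleton_true {p : ℝ} (h0 : 0 ≤ p) : (bern p).real {true} = p := by
  simp [Measure.real, bern, h0]

lemma bern_singleton_false {p : ℝ} (h1 : p ≤ 1) : (bern p).real {false} = 1 - p := by
  simp [Measure.real, bern, h1]

lemma isProbabilityMeasure_bern {p : ℝ} (h0 : 0 ≤ p) (h1 : p ≤ 1) :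
    IsProbabilityMeasure (bern p) := by
  constructor
  simp only [bern, Measure.coe_add, Measure.coe_smul, Pi.add_apply, Pi.smul_apply,
    smul_eq_mul, measure_univ, mul_one]
  rw [← ENNReal.ofReal_add h0 (by linarith)]
  simp

section ProductBernoulli

variable {ι : Type*} [Fintype ι] [DecidableEq ι]

/-- The configurations whose set of occurring indices inside `Q` is `J`. -/
def patternEvent (Q J : Finset ι) : Set (ι → Bool) :=
  {ω | ∀ e ∈ Q, ω e = decide (e ∈ J)}

lemma measureReal_patternEvent {p : ι → ℝ} (h0 : ∀ e, 0 ≤ p e) (h1 : ∀ e, p e ≤ 1)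
    {Q J : Finset ι} (hJ : J ⊆ Q) :
    (Measure.pi fun e => bern (p e)).real (patternEvent Q J) =
      (∏ e ∈ J, p e) * ∏ e ∈ Q \ J, (1 - p e) := by
  have := fun e => isProbabilityMeasure_bern (h0 e) (h1 e)
  have hset : patternEvent Q J =
      Set.pi Set.univ fun e => if e ∈ Q then {decide (e ∈ J)} else Set.univ := by
    ext ω
    simp only [patternEvent, Set.mem_ofPred_eq, Set.mem_pi, Set.mem_univ, true_implies]
    refine forall_congr' fun e => ?_
    by_cases he : e ∈ Q <;> simp [he]
  have hfac : ∀ e, (bern (p e)).real (if e ∈ Q then {decide (e ∈ J)} else Set.univ) =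
      (if e ∈ J then p e else 1) * if e ∈ Q \ J then 1 - p e else 1 := by
    intro e
    by_cases hQ : e ∈ Q
    · by_cases heJ : e ∈ J
      · simp [hQ, heJ, bern_singleton_true (h0 e)]
      · simp [hQ, heJ, bern_singleton_false (h1 e)]
    · have heJ : e ∉ J := fun h => hQ (hJ h)
      rw [if_neg hQ, probReal_univ]
      simp [hQ, heJ]
  rw [hset, Measure.real, Measure.pi_pi, ENNReal.toReal_prod]
  change ∏ e, (bern (p e)).real _ = _
  simp_rw [hfac, Finset.prod_mul_distrib, Finset.prod_ite_mem, Finset.univ_inter]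

lemma measureReal_patternEvent_inter {p : ι → ℝ} (h0 : ∀ e, 0 ≤ p e) (h1 : ∀ e, p e ≤ 1)
    {Q J : Finset ι} {E : Set (ι → Bool)}
    (hE : ∀ ω ω' : ι → Bool, (∀ e ∉ Q, ω e = ω' e) → ω ∈ E → ω' ∈ E) :
    (Measure.pi fun e => bern (p e)).real (patternEvent Q J ∩ E) =
      (Measure.pi fun e => bern (p e)).real (patternEvent Q J) *
        (Measure.pi fun e => bern (p e)).real E := by
  have := fun e => isProbabilityMeasure_bern (h0 e) (h1 e)
  have hind : ProbabilityTheory.iIndepFun (fun (e : ι) (ω : ι → Bool) => ω e)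
      (Measure.pi fun e => bern (p e)) :=
    ProbabilityTheory.iIndepFun_pi (X := fun _ => id) fun _ => aemeasurable_id
  have hind' := hind.indepFun_finset Q Qᶜ disjoint_compl_right fun e => measurable_pi_apply e
  have hA : patternEvent Q J =
      (fun (a : ι → Bool) (i : Q) => a i) ⁻¹' {x | ∀ i, x i = decide (i.1 ∈ J)} := by
    ext ω
    simp [patternEvent]
  have hB : E = (fun (a : ι → Bool) (i : (Qᶜ : Finset ι)) => a i) ⁻¹'
      ((fun (a : ι → Bool) (i : (Qᶜ : Finset ι)) => a i) '' E) := by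
    refine (Set.subset_preimage_image _ _).antisymm ?_
    rintro ω' ⟨ω, hω, h⟩
    refine hE ω ω' (fun e he => ?_) hω
    exact congrFun h ⟨e, by simpa using he⟩
  rw [Measure.real, Measure.real, Measure.real, ← ENNReal.toReal_mul]
  congr 1
  rw [hB, hA]
  exact hind'.measure_inter_preimage_eq_mul _ _ (Set.toFinite _).measurableSet
    (Set.toFinite _).measurableSet

/-- If, for each pattern `J` of occurring indices in `Q`, the event `E` is contained in an event
`F J` that does not depend on `Q` and has probability at most `c * w ^ J.card`, then the
probability of `E` is at most `c * exp (b * (w - 1))`, where `b` bounds the expected number of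
occurring indices in `Q`. -/
lemma measureReal_le_of_patternEvent {p : ι → ℝ} (h0 : ∀ e, 0 ≤ p e) (h1 : ∀ e, p e ≤ 1)
    (Q : Finset ι) (E : Set (ι → Bool)) (F : Finset ι → Set (ι → Bool))
    (hF : ∀ J ⊆ Q, ∀ ω ω' : ι → Bool, (∀ e ∉ Q, ω e = ω' e) → ω ∈ F J → ω' ∈ F J)
    (hEF : ∀ J ⊆ Q, patternEvent Q J ∩ E ⊆ F J)
    {b c w : ℝ} (hc : 0 ≤ c) (hw : 1 ≤ w) (hb : ∑ e ∈ Q, p e ≤ b)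
    (hbound : ∀ J ⊆ Q, (Measure.pi fun e => bern (p e)).real (F J) ≤ c * w ^ J.card) :
    (Measure.pi fun e => bern (p e)).real E ≤ c * exp (b * (w - 1)) := by
  have := fun e => isProbabilityMeasure_bern (h0 e) (h1 e)
  set μ := Measure.pi fun e => bern (p e) with hμ
  have hcover : E ⊆ ⋃ J ∈ Q.powerset, patternEvent Q J ∩ F J := by
    intro ω hω
    have hsub : Q.filter (fun e => ω e = true) ⊆ Q := Finset.filter_subset _ _
    have hpat : ω ∈ patternEvent Q (Q.filter fun e => ω e = true) := by
      intro e he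
      simp [he]
    simp only [Set.mem_iUnion]
    exact ⟨_, Finset.mem_powerset.2 hsub, hpat, hEF _ hsub ⟨hpat, hω⟩⟩
  calc μ.real E ≤ μ.real (⋃ J ∈ Q.powerset, patternEvent Q J ∩ F J) :=
        measureReal_mono hcover (measure_ne_top _ _)
    _ ≤ ∑ J ∈ Q.powerset, μ.real (patternEvent Q J ∩ F J) :=
        measureReal_biUnion_finset_le _ _
    _ ≤ ∑ J ∈ Q.powerset, c * ((∏ e ∈ J, p e * w) * ∏ e ∈ Q \ J, (1 - p e)) := by
        refine Finset.sum_le_sum fun J hJ => ?_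
        have hJ' := Finset.mem_powerset.1 hJ
        rw [measureReal_patternEvent_inter h0 h1 (hF J hJ'), measureReal_patternEvent h0 h1 hJ']
        have hpos : 0 ≤ (∏ e ∈ J, p e) * ∏ e ∈ Q \ J, (1 - p e) :=
          mul_nonneg (Finset.prod_nonneg fun e _ => h0 e)
            (Finset.prod_nonneg fun e _ => sub_nonneg.2 (h1 e))
        refine (mul_le_mul_of_nonneg_left (hbound J hJ') hpos).trans_eq ?_
        rw [Finset.prod_mul_distrib, Finset.prod_const]
        ring
    _ = c * ∏ e ∈ Q, (p e * w + (1 - p e)) := by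
        rw [Finset.prod_add, Finset.mul_sum]
    _ ≤ c * ∏ e ∈ Q, exp (p e * (w - 1)) := by
        refine mul_le_mul_of_nonneg_left (Finset.prod_le_prod (fun e _ => ?_) fun e _ => ?_) hc
        · nlinarith [h0 e, h1 e]
        · linarith [add_one_le_exp (p e * (w - 1))]
    _ ≤ c * exp (b * (w - 1)) := by
        rw [← exp_sum, ← Finset.sum_mul]
        gcongr

end ProductBernoulli

/-- Every vertex set containing `R` and closed under propagation through those edges of `ω` that
have at least two vertices outside `A` has at least `m` vertices. -/
def largeClosure {n : ℕ} (A R : Finset (Fin n)) (m : ℕ) : Set (EdgeIdx n → Bool) :=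
  {ω | ∀ W : Finset (Fin n), R ⊆ W →
    (∀ e : EdgeIdx n, ω e = true → 2 ≤ (e.1 \ A).card → (e.1 \ W).card ≤ 1 → e.1 ⊆ W) →
    m ≤ W.card}

/-- The edges whose occurrence has to be revealed when the vertex `v` of the reached set `R` is
added to the set `A` of explored vertices. -/
def revealedEdges {n : ℕ} (A R : Finset (Fin n)) (v : Fin n) : Finset (EdgeIdx n) :=
  Finset.univ.filter fun e =>
    2 ≤ (e.1 \ A).card ∧ (e.1 \ insert v A).card ≤ 1 ∧ ¬ e.1 ⊆ R

/-- The reached set after the edges in `J` have been found to occur. -/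
def reachedBy {n : ℕ} (R : Finset (Fin n)) (J : Finset (EdgeIdx n)) : Finset (Fin n) :=
  R ∪ J.biUnion fun e => e.1

lemma largeClosure_self_eq_empty {n m : ℕ} {A : Finset (Fin n)} (h : A.card < m) :
    largeClosure A A m = ∅ := by
  refine Set.eq_empty_of_forall_notMem fun ω hω => ?_
  have := hω A subset_rfl fun e _ h2 h1 => absurd h1 (by omega)
  omega

lemma patternEvent_inter_largeClosure_subset {n m : ℕ} {A R : Finset (Fin n)} {v : Fin n}
    {J : Finset (EdgeIdx n)} :
    patternEvent (revealedEdges A R v) J ∩ largeClosure A R m ⊆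
      largeClosure (insert v A) (reachedBy R J) m := by
  rintro ω ⟨hJ, hω⟩ W hW hclosed
  have hRW : R ⊆ W := Finset.subset_union_left.trans hW
  refine hω W hRW fun e he h2 h1 => ?_
  by_cases h2' : 2 ≤ (e.1 \ insert v A).card
  · exact hclosed e he h2' h1
  by_cases heR : e.1 ⊆ R
  · exact heR.trans hRW
  have heQ : e ∈ revealedEdges A R v := by
    simp only [revealedEdges, Finset.mem_filter, Finset.mem_univ, true_and]
    exact ⟨h2, by omega, heR⟩
  have heJ : e ∈ J := by
    have := hJ e heQ
    rw [he] at this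
    simpa using this.symm
  exact (Finset.subset_biUnion_of_mem (fun e : EdgeIdx n => e.1) heJ).trans
    (Finset.subset_union_right.trans hW)

lemma largeClosure_congr {n m : ℕ} {A R R' : Finset (Fin n)} {v : Fin n}
    {ω ω' : EdgeIdx n → Bool} (h : ∀ e ∉ revealedEdges A R v, ω e = ω' e)
    (hω : ω ∈ largeClosure (insert v A) R' m) : ω' ∈ largeClosure (insert v A) R' m := by
  intro W hW hclosed
  refine hω W hW fun e he h2 h1 => hclosed e ?_ h2 h1
  rw [← h e, he]
  simp only [revealedEdges, Finset.mem_filter, Finset.mem_univ, true_and]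
  omega

lemma card_reachedBy_le {n : ℕ} {A R : Finset (Fin n)} {v : Fin n} (hAR : A ⊆ R) (hv : v ∈ R)
    {J : Finset (EdgeIdx n)} (hJ : J ⊆ revealedEdges A R v) :
    (reachedBy R J).card ≤ R.card + J.card := by
  have hsub : reachedBy R J ⊆ R ∪ J.biUnion fun e => e.1 \ R := by
    intro x
    simp only [reachedBy, Finset.mem_union, Finset.mem_biUnion, Finset.mem_sdiff]
    rintro (h | ⟨e, he, hx⟩)
    · exact Or.inl h
    · by_cases hxR : x ∈ R
      · exact Or.inl hxR
      · exact Or.inr ⟨e, he, hx, hxR⟩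
  refine (Finset.card_le_card hsub).trans ((Finset.card_union_le _ _).trans ?_)
  gcongr
  refine (Finset.card_biUnion_le_card_mul J _ 1 fun e he => ?_).trans_eq (mul_one _)
  have := hJ he
  simp only [revealedEdges, Finset.mem_filter, Finset.mem_univ, true_and] at this
  refine (Finset.card_le_card ?_).trans this.2.1
  exact Finset.sdiff_subset_sdiff subset_rfl (Finset.insert_subset hv hAR)

lemma exists_sdiff_eq_pair_of_mem_revealedEdges {n : ℕ} {A R : Finset (Fin n)} {v : Fin n}
    {e : EdgeIdx n} (he : e ∈ revealedEdges A R v) : ∃ u, e.1 \ A = {v, u} := by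
  simp only [revealedEdges, Finset.mem_filter, Finset.mem_univ, true_and] at he
  obtain ⟨h2, h1, -⟩ := he
  have hins : e.1 \ insert v A = (e.1 \ A).erase v := by
    ext x
    simp only [Finset.mem_sdiff, Finset.mem_insert, Finset.mem_erase]
    tauto
  rw [hins] at h1
  have hv : v ∈ e.1 \ A := by
    by_contra hv
    rw [Finset.erase_eq_of_notMem hv] at h1
    omega
  have hcard := Finset.card_erase_add_one hv
  obtain ⟨u, hu⟩ := Finset.card_eq_one.1 (show ((e.1 \ A).erase v).card = 1 by omega)
  exact ⟨u, by rw [← hu, Finset.insert_erase hv]⟩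

lemma card_pairs_revealedEdges_le {n : ℕ} (A R : Finset (Fin n)) (v : Fin n) :
    ((revealedEdges A R v).filter fun e => e.1.card = 2).card ≤ n := by
  have hmaps : ((revealedEdges A R v).filter fun e => e.1.card = 2).image (fun e => e.1) ⊆
      Finset.univ.image fun u : Fin n => ({v, u} : Finset (Fin n)) := by
    intro s hs
    obtain ⟨e, he, rfl⟩ := Finset.mem_image.1 hs
    obtain ⟨heQ, hcard⟩ := Finset.mem_filter.1 he
    obtain ⟨u, hu⟩ := exists_sdiff_eq_pair_of_mem_revealedEdges heQ
    have h2 : 2 ≤ (e.1 \ A).card := (Finset.mem_filter.1 heQ).2.1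
    refine Finset.mem_image.2 ⟨u, Finset.mem_univ _, ?_⟩
    rw [← hu]
    exact Finset.eq_of_subset_of_card_le Finset.sdiff_subset (by omega)
  rw [← Finset.card_image_of_injective _ Subtype.val_injective]
  refine (Finset.card_le_card hmaps).trans (Finset.card_image_le.trans ?_)
  simp

lemma card_triples_revealedEdges_le {n : ℕ} (A R : Finset (Fin n)) (v : Fin n) :
    ((revealedEdges A R v).filter fun e => ¬ e.1.card = 2).card ≤ A.card * n := by
  have hmaps : ((revealedEdges A R v).filter fun e => ¬ e.1.card = 2).image (fun e => e.1) ⊆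
      (A ×ˢ Finset.univ).image fun x : Fin n × Fin n => ({x.1, v, x.2} : Finset (Fin n)) := by
    intro s hs
    obtain ⟨e, he, rfl⟩ := Finset.mem_image.1 hs
    obtain ⟨heQ, hcard⟩ := Finset.mem_filter.1 he
    obtain ⟨u, hu⟩ := exists_sdiff_eq_pair_of_mem_revealedEdges heQ
    have h2 : 2 ≤ (e.1 \ A).card := (Finset.mem_filter.1 heQ).2.1
    have h2' : (e.1 \ A).card ≤ 2 := hu ▸ Finset.card_le_two
    have h3 : e.1.card = 3 := e.2.resolve_left hcard
    have hsplit := Finset.card_sdiff_add_card_inter e.1 A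
    obtain ⟨a, ha⟩ := Finset.card_eq_one.1 (show (e.1 ∩ A).card = 1 by omega)
    have haA : a ∈ A := by
      have : a ∈ e.1 ∩ A := ha ▸ Finset.mem_singleton_self a
      exact (Finset.mem_inter.1 this).2
    refine Finset.mem_image.2 ⟨(a, u), by simp [haA], ?_⟩
    rw [← Finset.sdiff_union_inter e.1 A, hu, ha, Finset.union_comm]
    rfl
  rw [← Finset.card_image_of_injective _ Subtype.val_injective]
  refine (Finset.card_le_card hmaps).trans (Finset.card_image_le.trans ?_)
  simp

lemma sum_revealedEdges_le {n : ℕ} (A R : Finset (Fin n)) (v : Fin n) {p q : ℝ} (hp : 0 ≤ p)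
    (hq : 0 ≤ q) :
    ∑ e ∈ revealedEdges A R v, (if e.1.card = 2 then p else q) ≤ n * p + A.card * n * q := by
  rw [Finset.sum_ite, Finset.sum_const, Finset.sum_const, nsmul_eq_mul, nsmul_eq_mul]
  gcongr
  · exact card_pairs_revealedEdges_le A R v
  · exact_mod_cast card_triples_revealedEdges_le A R v

lemma propComponent_subset {n : ℕ} {ω : EdgeIdx n → Bool} {S W : Finset (Fin n)} (hS : S ⊆ W)
    (hW : ∀ e : EdgeIdx n, ω e = true → (e.1 \ W).card ≤ 1 → e.1 ⊆ W) :
    propComponent ω S ⊆ W := by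
  rintro x (hx | ⟨k, f, ⟨hedge, hprop⟩, i, hi, hx⟩)
  · exact hS hx
  have key : ∀ l < k, f l ⊆ W := by
    intro l
    induction l using Nat.strong_induction_on with
    | _ l ih =>
      intro hl
      obtain ⟨hcard, he⟩ := hedge l hl
      refine hW ⟨f l, hcard⟩ he ?_
      have hsub : S ∪ (Finset.range l).biUnion f ⊆ W :=
        Finset.union_subset hS (Finset.biUnion_subset.2 fun j hj =>
          ih j (Finset.mem_range.1 hj) ((Finset.mem_range.1 hj).trans hl))
      have hle : (f l ∩ (S ∪ (Finset.range l).biUnion f)).card ≤ (f l ∩ W).card :=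
        Finset.card_le_card (Finset.inter_subset_inter subset_rfl hsub)
      have hsplit := Finset.card_sdiff_add_card_inter (f l) W
      have := hprop l hl
      change (f l \ W).card ≤ 1
      omega
  exact key i hi hx

lemma mem_largeClosure_of_le_ncard {n m : ℕ} {ω : EdgeIdx n → Bool} {S : Finset (Fin n)}
    (h : m ≤ (propComponent ω S).ncard) : ω ∈ largeClosure ∅ S m := by
  intro W hSW hclosed
  refine h.trans ?_
  rw [← Set.ncard_coe_finset W]
  refine Set.ncard_le_ncard (propComponent_subset hSW fun e he h1 => hclosed e he ?_ h1)
    W.finite_toSet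
  rw [Finset.sdiff_empty]
  rcases e.2 with h | h <;> omega

/-- The law of the random hypergraph whose pairs occur with probability `p` and whose triples
occur with probability `q`. -/
noncomputable abbrev edgeLaw (n : ℕ) (p q : ℝ) : Measure (EdgeIdx n → Bool) :=
  Measure.pi fun e => bern (if e.1.card = 2 then p else q)

/-- Chernoff bound for the exploration process: `lam t` bounds the expected number of edges
revealed by exploring one more vertex after `t` vertices, and `θ t` is the exponential tilt used
at that step. -/
lemma measureReal_largeClosure_le {n m N : ℕ} {p q : ℝ} (hp0 : 0 ≤ p) (hp1 : p ≤ 1)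
    (hq0 : 0 ≤ q) (hq1 : q ≤ 1) {lam θ : ℕ → ℝ} (hθ : Antitone θ) (hθ0 : ∀ t, 0 ≤ θ t)
    (hlam : ∀ t < N, n * p + t * n * q ≤ lam t) (hm : N < m)
    (A R : Finset (Fin n)) (hAR : A ⊆ R) (hAN : A.card ≤ N) :
    (edgeLaw n p q).real (largeClosure A R m) ≤
      exp ((R.card - A.card - 1) * θ A.card -
        ∑ i ∈ Finset.Ico A.card N, (θ i - lam i * (exp (θ i) - 1))) := by
  have h0 : ∀ e : EdgeIdx n, 0 ≤ if e.1.card = 2 then p else q := fun e => by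
    split_ifs <;> assumption
  have h1 : ∀ e : EdgeIdx n, (if e.1.card = 2 then p else q) ≤ 1 := fun e => by
    split_ifs <;> assumption
  have hprob := fun e => isProbabilityMeasure_bern (h0 e) (h1 e)
  obtain ⟨j, hj⟩ := Nat.exists_eq_add_of_le hAN
  induction j generalizing A R with
  | zero =>
    rcases hAR.eq_or_ssubset with rfl | hss
    · rw [largeClosure_self_eq_empty (by omega), measureReal_empty]
      positivity
    · have hlt : (A.card : ℝ) + 1 ≤ R.card := by exact_mod_cast Finset.card_lt_card hss
      refine measureReal_le_one.trans (one_le_exp ?_)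
      rw [Finset.Ico_eq_empty (by omega), Finset.sum_empty, sub_zero]
      exact mul_nonneg (by linarith) (hθ0 _)
  | succ j ih =>
    rcases hAR.eq_or_ssubset with rfl | hss
    · rw [largeClosure_self_eq_empty (by omega), measureReal_empty]
      positivity
    obtain ⟨v, hvR, hvA⟩ := Finset.exists_of_ssubset hss
    have hcard : (insert v A).card = A.card + 1 := Finset.card_insert_of_notMem hvA
    set t := A.card with ht
    set H := ∑ i ∈ Finset.Ico (t + 1) N, (θ i - lam i * (exp (θ i) - 1)) with hH
    have hsum : ∑ i ∈ Finset.Ico t N, (θ i - lam i * (exp (θ i) - 1)) =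
        θ t - lam t * (exp (θ t) - 1) + H :=
      Finset.sum_eq_sum_Ico_succ_bot (by omega) _
    have hstep := measureReal_le_of_patternEvent h0 h1 (revealedEdges A R v)
      (largeClosure A R m) (fun J => largeClosure (insert v A) (reachedBy R J) m)
      (fun J _ ω ω' h hω => largeClosure_congr h hω)
      (fun J _ => patternEvent_inter_largeClosure_subset)
      (b := lam t) (c := exp ((R.card - t - 2) * θ t - H)) (w := exp (θ t))
      (exp_pos _).le (one_le_exp (hθ0 t))
      ((sum_revealedEdges_le A R v hp0 hq0).trans (hlam t (by omega))) ?_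
    · refine hstep.trans_eq ?_
      rw [← exp_add, hsum]
      congr 1
      ring
    intro J hJ
    have hsub : insert v A ⊆ reachedBy R J :=
      (Finset.insert_subset hvR hAR).trans Finset.subset_union_left
    rcases hsub.eq_or_ssubset with heq | hss'
    · rw [← heq, largeClosure_self_eq_empty (by omega), measureReal_empty]
      positivity
    have hih := ih (insert v A) (reachedBy R J) hsub (by omega) (by omega)
    rw [hcard, ← hH] at hih
    refine hih.trans ?_
    rw [← exp_nat_mul, ← exp_add]
    have hlow : (t : ℝ) + 2 ≤ (reachedBy R J).card := by
      have := Finset.card_lt_card hss'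
      rw [hcard] at this
      exact_mod_cast this
    have hup : ((reachedBy R J).card : ℝ) ≤ R.card + J.card := by
      exact_mod_cast card_reachedBy_le hAR hvR hJ
    have hθt : θ (t + 1) ≤ θ t := hθ (Nat.le_succ t)
    have e1 : ((reachedBy R J).card - (t + 2) : ℝ) * θ (t + 1) ≤
        ((reachedBy R J).card - (t + 2)) * θ t :=
      mul_le_mul_of_nonneg_left hθt (by linarith)
    have e2 := mul_le_mul_of_nonneg_right hup (hθ0 t)
    rw [exp_le_exp]
    push_cast
    linarith

/-- The rate function `u - 1 - log u` at the left endpoint of an interval in `(0, 1]` bounds the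
increment of its primitive. -/
lemma primitive_sub_le {a b : ℝ} (ha : 0 < a) (hab : a ≤ b) (hb : b ≤ 1) :
    (b ^ 2 / 2 - b * log b) - (a ^ 2 / 2 - a * log a) ≤ (a - 1 - log a) * (b - a) := by
  rcases hab.eq_or_lt with rfl | hlt
  · simp
  have hderiv : ∀ x ∈ Set.Icc a b,
      HasDerivAt (fun u : ℝ => u ^ 2 / 2 - u * log u) (x - 1 - log x) x := by
    intro x hx
    have hx0 : x ≠ 0 := (ha.trans_le hx.1).ne'
    refine (((hasDerivAt_pow 2 x).div_const 2).sub
      ((hasDerivAt_id x).mul (hasDerivAt_log hx0))).congr_deriv ?_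
    simp only [id_eq]
    field_simp
    push_cast
    ring
  obtain ⟨c, hc, hslope⟩ := exists_hasDerivAt_eq_slope (fun u : ℝ => u ^ 2 / 2 - u * log u)
    (fun x => x - 1 - log x) hlt
    (fun x hx => (hderiv x hx).continuousAt.continuousWithinAt)
    (fun x hx => hderiv x ⟨hx.1.le, hx.2.le⟩)
  have hba : 0 < b - a := sub_pos.2 hlt
  rw [eq_div_iff hba.ne'] at hslope
  rw [← hslope]
  refine mul_le_mul_of_nonneg_right ?_ hba.le
  have hc0 : 0 < c := ha.trans hc.1
  have hlog := one_sub_inv_le_log_of_pos (div_pos hc0 ha)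
  rw [log_div hc0.ne' ha.ne', inv_div] at hlog
  have hfrac : c - a ≤ 1 - a / c := by
    rw [one_sub_div hc0.ne', le_div_iff₀ hc0]
    nlinarith [hc.1, hc.2]
  linarith

/-- Left Riemann sums of the rate function `u - 1 - log u` along a grid of mesh at most `δ`
ending at `1`. -/
lemma primitive_le_sum {x : ℕ → ℝ} {δ : ℝ} {N : ℕ} (hpos : ∀ t, 0 < x t) (hmono : Monotone x)
    (hle : ∀ t, x t ≤ 1) (hδ : ∀ t, x (t + 1) - x t ≤ δ) (hN : x N = 1) :
    1 / 2 - (x 0 ^ 2 / 2 - x 0 * log (x 0)) ≤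
      δ * ∑ t ∈ Finset.range N, (x t - 1 - log (x t)) := by
  have htel := Finset.sum_range_sub (fun t => x t ^ 2 / 2 - x t * log (x t)) N
  rw [hN, log_one, mul_zero, sub_zero, one_pow] at htel
  rw [← htel, Finset.mul_sum]
  refine Finset.sum_le_sum fun t _ => ?_
  have h1 := primitive_sub_le (hpos t) (hmono (Nat.le_succ t)) (hle (t + 1))
  have h2 : 0 ≤ x t - 1 - log (x t) := by linarith [log_le_sub_one_of_pos (hpos t)]
  nlinarith [mul_le_mul_of_nonneg_left (hδ t) h2]

lemma measureReal_largeClosure_singleton_le {ε r : ℝ} (hε0 : 0 < ε) (hε1 : ε < 1) (hr : 0 < r)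
    {n : ℕ} (hn1 : 1 ≤ log n) (hnr : r ≤ log n) (v : Fin n) :
    (hypMeasure n ε r).real (largeClosure ∅ {v} (⌊ε * log n / r⌋₊ + 2)) ≤
      exp (Ier ε r * log n) := by
  set L := log n with hL
  set N := ⌊ε * L / r⌋₊ + 1 with hN
  have hL0 : 0 < L := by linarith
  have hn : (1 : ℝ) ≤ n := by exact_mod_cast v.pos
  have hn0 : (n : ℝ) ≠ 0 := by positivity
  have hnL : r ≤ n * L := hnr.trans (le_mul_of_one_le_left hL0.le hn)
  set x : ℕ → ℝ := fun t => min 1 (1 - ε + r * t / L) with hx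
  have hpos : ∀ t, 0 < x t := fun t =>
    lt_min one_pos (add_pos_of_pos_of_nonneg (by linarith) (by positivity))
  have hmono : Monotone x := by
    intro s t hst
    simp only [hx]
    gcongr
  have hle : ∀ t, x t ≤ 1 := fun t => min_le_left _ _
  have hsmall : ∀ t < N, 1 - ε + r * t / L ≤ 1 := by
    intro t ht
    have h1 : (t : ℝ) ≤ ε * L / r :=
      (Nat.le_floor_iff (by positivity)).1 (Nat.lt_succ_iff.1 ht)
    have h2 : r * t / L ≤ ε := by
      rw [div_le_iff₀ hL0]
      rw [le_div_iff₀ hr] at h1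
      linarith
    linarith
  have hxN : x N = 1 := by
    refine min_eq_left ?_
    have h1 : ε * L / r < N := by
      rw [hN]
      push_cast
      exact Nat.lt_floor_add_one _
    have h2 : ε ≤ r * N / L := by
      rw [le_div_iff₀ hL0]
      rw [div_lt_iff₀ hr] at h1
      linarith
    linarith
  have hδ : ∀ t, x (t + 1) - x t ≤ r / L := by
    intro t
    have hstep : 1 - ε + r * ((t + 1 : ℕ) : ℝ) / L = 1 - ε + r * t / L + r / L := by
      push_cast
      ring
    have hrL : 0 < r / L := by positivity
    simp only [hx, hstep]
    rcases min_cases 1 (1 - ε + r * t / L) with h | h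
    · linarith [min_le_left 1 (1 - ε + r * t / L + r / L)]
    · linarith [min_le_right 1 (1 - ε + r * t / L + r / L)]
  have hsum := primitive_le_sum hpos hmono hle hδ hxN
  have hx0 : x 0 = 1 - ε := by
    simp only [hx]
    rw [min_eq_right] <;> simp [hε0.le]
  have hchernoff := measureReal_largeClosure_le (n := n) (m := N + 1) (N := N)
    (p := (1 - ε) / n) (q := r / (n * L)) (div_nonneg (by linarith) (by linarith))
    ((div_le_one (by positivity)).2 (by linarith)) (by positivity)
    ((div_le_one (by positivity)).2 hnL) (lam := x) (θ := fun t => -log (x t))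
    (fun s t hst => by simpa using log_le_log (hpos s) (hmono hst))
    (fun t => neg_nonneg.2 (log_nonpos (hpos t).le (hle t)))
    (fun t ht => by
      simp only [hx, min_eq_right (hsmall t ht)]
      apply le_of_eq
      field_simp)
    (Nat.lt_succ_self N) ∅ {v} (Finset.empty_subset _) (by simp)
  refine hchernoff.trans (exp_le_exp.2 ?_)
  have hterm : ∀ t, -log (x t) - x t * (exp (-log (x t)) - 1) = x t - 1 - log (x t) := by
    intro t
    rw [exp_neg, exp_log (hpos t), mul_sub, mul_inv_cancel₀ (hpos t).ne']
    ring
  simp only [Finset.card_singleton, Finset.card_empty, hterm, ← Finset.range_eq_Ico]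
  set S := ∑ t ∈ Finset.range N, (x t - 1 - log (x t))
  rw [hx0, div_mul_eq_mul_div, le_div_iff₀ hL0] at hsum
  have hI : -(Ier ε r * L) ≤ S := by
    rw [Ier, ← sub_nonneg]
    have hrw : S - -(-(1 / r) * (ε - ε ^ 2 / 2 + (1 - ε) * log (1 - ε)) * L) =
        (r * S - (1 / 2 - ((1 - ε) ^ 2 / 2 - (1 - ε) * log (1 - ε))) * L) / r := by
      field_simp
      ring
    rw [hrw]
    exact div_nonneg (by linarith) hr.le
  push_cast
  linarith

lemma floor_add_two_le_of_K0_mul_le {ε r L : ℝ} (hε0 : 0 < ε) (hr : 0 < r) (hrL : r ≤ L) {k : ℕ}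
    (hk : K0 ε r * L ≤ k) : ⌊ε * L / r⌋₊ + 2 ≤ k := by
  have hL : 0 < L := hr.trans_le hrL
  have h1 : 2 * (9 + ε) / r * L ≤ k :=
    (mul_le_mul_of_nonneg_right (le_max_right _ _) hL.le).trans hk
  have h2 : (⌊ε * L / r⌋₊ : ℝ) ≤ ε * L / r := Nat.floor_le (by positivity)
  have h3 : 1 ≤ L / r := (one_le_div hr).2 hrL
  have h4 : 2 * (9 + ε) / r * L = 18 * (L / r) + 2 * (ε * L / r) := by ring
  have h5 : 0 ≤ ε * L / r := by positivity
  have : ((⌊ε * L / r⌋₊ + 2 : ℕ) : ℝ) ≤ k := by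
    push_cast
    linarith
  exact_mod_cast this

lemma hypMeasure_large_component_le {ε r : ℝ} (hε0 : 0 < ε) (hε1 : ε < 1) (hr : 0 < r)
    {n : ℕ} (hn1 : 1 ≤ log n) (hnr : r ≤ log n) :
    hypMeasure n ε r
        {ω | ∃ v : Fin n, K0 ε r * log n ≤ ((propComponent ω {v}).ncard : ℝ)} ≤
      ENNReal.ofReal (exp ((1 + Ier ε r) * log n)) := by
  have hfin : IsFiniteMeasure (hypMeasure n ε r) := by
    unfold hypMeasure
    infer_instance
  have hn0 : (0 : ℝ) < n := by
    rcases n.eq_zero_or_pos with rfl | h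
    · norm_num at hn1
    · exact_mod_cast h
  have hcover : {ω | ∃ v : Fin n, K0 ε r * log n ≤ ((propComponent ω {v}).ncard : ℝ)} ⊆
      ⋃ v ∈ (Finset.univ : Finset (Fin n)),
        largeClosure ∅ {v} (⌊ε * log n / r⌋₊ + 2) := by
    rintro ω ⟨v, hv⟩
    simp only [Set.mem_iUnion]
    refine ⟨v, Finset.mem_univ v, mem_largeClosure_of_le_ncard ?_⟩
    exact floor_add_two_le_of_K0_mul_le hε0 hr hnr (by simpa using hv)
  rw [← ofReal_measureReal]
  refine ENNReal.ofReal_le_ofReal ?_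
  calc _ ≤ (hypMeasure n ε r).real (⋃ v ∈ (Finset.univ : Finset (Fin n)),
        largeClosure ∅ {v} (⌊ε * log n / r⌋₊ + 2)) :=
        measureReal_mono hcover (measure_ne_top _ _)
    _ ≤ ∑ v : Fin n, (hypMeasure n ε r).real
        (largeClosure ∅ {v} (⌊ε * log n / r⌋₊ + 2)) := measureReal_biUnion_finset_le _ _
    _ ≤ ∑ _v : Fin n, exp (Ier ε r * log n) := Finset.sum_le_sum fun v _ =>
        measureReal_largeClosure_singleton_le hε0 hε1 hr hn1 hnr v
    _ = exp ((1 + Ier ε r) * log n) := by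
        rw [Finset.sum_const, Finset.card_univ, Fintype.card_fin, nsmul_eq_mul, add_mul, exp_add,
          one_mul, exp_log hn0]

/-- If `I_{ε,r} < -1` then w.h.p. every propagation component of `𝔾(n,p₂,p₃)` has
fewer than `K₀ ln n` vertices. -/
theorem no_large_component_subcritical (ε r : ℝ) (hε0 : 0 < ε) (hε1 : ε < 1)
    (hr : 0 < r) (hI : Ier ε r < -1) :
    Tendsto
      (fun n : ℕ => hypMeasure n ε r
        {ω | ∃ v : Fin n, K0 ε r * Real.log n ≤ ((propComponent ω {v}).ncard : ℝ)})
      atTop (nhds 0) := by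
  have hlog : Tendsto (fun n : ℕ => log (n : ℝ)) atTop atTop :=
    tendsto_log_atTop.comp tendsto_natCast_atTop_atTop
  have hlim : Tendsto (fun n : ℕ => ENNReal.ofReal (exp ((1 + Ier ε r) * log n))) atTop
      (nhds 0) := by
    rw [← ENNReal.ofReal_zero]
    exact (ENNReal.continuous_ofReal.tendsto 0).comp
      (tendsto_exp_atBot.comp (hlog.const_mul_atTop_of_neg (by linarith)))
  refine tendsto_of_tendsto_of_tendsto_of_le_of_le' tendsto_const_nhds hlim
    (Eventually.of_forall fun _ => zero_le) ?_
  filter_upwards [hlog.eventually_ge_atTop 1, hlog.eventually_ge_atTop r] with n h1 h2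
  exact hypMeasure_large_component_le hε0 hε1 hr h1 h2
end

section
/- Let 0 < r < 1/4 be a constant and for each integer n ≥ 3 set p = r/(n·ln n). Let H(n,p) be the random 3-uniform hypergraph on vertex set {1,…,n} in which each 3-element subset is an edge independently with probability p. Then the probability that H(n,p) is propagation connected tends to 0 as n → ∞. -/
open MeasureTheory Real Filter

/-- Index type of potential edges of a 3-uniform hypergraph: subsets of size 3. -/
abbrev Edge3Idx (n : ℕ) := {e : Finset (Fin n) // e.card = 3}

/-- The law of the random 3-uniform hypergraph `H(n,p)` with `p = r/(n ln n)`: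
the product of Bernoulli measures over all 3-subsets of the vertex set. -/
noncomputable def hyp3Measure (n : ℕ) (r : ℝ) : Measure (Edge3Idx n → Bool) :=
  Measure.pi fun _ => bern (r / (n * Real.log n))

/-- `e` is an edge of the configuration `ω`. -/
def IsEdge3 {n : ℕ} (ω : Edge3Idx n → Bool) (e : Finset (Fin n)) : Prop :=
  ∃ h : e.card = 3, ω ⟨e, h⟩ = true

/-- Propagation connectivity: there is a sequence of edges `e₁, …, e_m` covering all
vertices such that each subsequent edge meets the union of the previous ones in all
but exactly one vertex. (Here `f l` is the edge `e_{l+1}`.) -/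
def PropConnected3 {n : ℕ} (ω : Edge3Idx n → Bool) : Prop :=
  ∃ (m : ℕ) (f : ℕ → Finset (Fin n)),
    (∀ i < m, IsEdge3 ω (f i)) ∧
    (Finset.range m).biUnion f = Finset.univ ∧
    ∀ l, 1 ≤ l → l < m →
      (f l ∩ (Finset.range l).biUnion f).card = (f l).card - 1

lemma bern_isProbabilityMeasure {p : ℝ} (hp0 : 0 ≤ p) (hp1 : p ≤ 1) :
    IsProbabilityMeasure (bern p) := by
  constructor
  simp only [bern, Measure.coe_add, Measure.coe_smul, Pi.add_apply, Pi.smul_apply,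
    measure_univ, smul_eq_mul, mul_one]
  rw [← ENNReal.ofReal_add hp0 (by linarith)]
  simp

lemma integral_bern {p : ℝ} (hp0 : 0 ≤ p) (hp1 : p ≤ 1) (f : Bool → ℝ) :
    ∫ b, f b ∂bern p = p * f true + (1 - p) * f false := by
  rw [bern, integral_add_measure
    (Integrable.of_finite.smul_measure ENNReal.ofReal_ne_top)
    (Integrable.of_finite.smul_measure ENNReal.ofReal_ne_top), integral_smul_measure,
    integral_smul_measure, integral_dirac, integral_dirac, ENNReal.toReal_ofReal hp0,
    ENNReal.toReal_ofReal (by linarith)]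
  simp

/-- Events depending on disjoint sets of coordinates are independent under a product measure. -/
lemma pi_real_inter_of_dependsOn {ι : Type*} [Fintype ι] [DecidableEq ι] {β : Type*}
    [Finite β] [Nonempty β] [MeasurableSpace β] [DiscreteMeasurableSpace β]
    (μ : ι → Measure β) [∀ i, IsProbabilityMeasure (μ i)] (S : Finset ι)
    {P Q : (ι → β) → Prop} (hP : DependsOn P (S : Set ι))
    (hQ : DependsOn Q ((Sᶜ : Finset ι) : Set ι)) :
    (Measure.pi μ).real {ω | P ω ∧ Q ω} =
      (Measure.pi μ).real {ω | P ω} * (Measure.pi μ).real {ω | Q ω} := by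
  have hind := ProbabilityTheory.iIndepFun.indepFun_finset S Sᶜ disjoint_compl_right
    (ProbabilityTheory.iIndepFun_pi (μ := μ) (X := fun _ b => b)
      fun i => measurable_id.aemeasurable) (fun i => measurable_pi_apply i)
  obtain ⟨P', hP'⟩ := dependsOn_iff_exists_comp.1 hP
  obtain ⟨Q', hQ'⟩ := dependsOn_iff_exists_comp.1 hQ
  have := hind.measure_inter_preimage_eq_mul {x | P' x} {x | Q' x}
    (MeasurableSet.of_discrete) (MeasurableSet.of_discrete)
  simp only [measureReal_def, ← ENNReal.toReal_mul]
  subst hP' hQ'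
  exact congrArg ENNReal.toReal this

/-- The vertices outside `D ∪ A` that span an edge together with `v` and a vertex of `D`. -/
noncomputable def discovered {n : ℕ} (ω : Edge3Idx n → Bool) (D A : Finset (Fin n))
    (v : Fin n) : Finset (Fin n) :=
  open scoped Classical in
  Finset.univ.filter fun w => w ∉ D ∧ w ∉ A ∧ ∃ u ∈ D, IsEdge3 ω {u, v, w}

/-- The exploration with processed vertices `D` and active vertices `A` can be run for `k` more
steps: each step processes the least active vertex and activates the vertices it discovers. -/
def Survives {n : ℕ} (ω : Edge3Idx n → Bool) : ℕ → Finset (Fin n) → Finset (Fin n) → Prop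
  | 0, _, _ => True
  | k + 1, D, A => ∃ h : A.Nonempty, Survives ω k (insert (A.min' h) D)
      (A.erase (A.min' h) ∪ discovered ω D A (A.min' h))

lemma mem_discovered {n : ℕ} {ω : Edge3Idx n → Bool} {D A : Finset (Fin n)} {v w : Fin n} :
    w ∈ discovered ω D A v ↔ w ∉ D ∧ w ∉ A ∧ ∃ u ∈ D, IsEdge3 ω {u, v, w} := by
  simp [discovered]

lemma disjoint_step {n : ℕ} {ω : Edge3Idx n → Bool} {D A : Finset (Fin n)} {v : Fin n}
    (hv : v ∈ A) (hDA : Disjoint D A) :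
    Disjoint (insert v D) (A.erase v ∪ discovered ω D A v) := by
  rw [Finset.disjoint_left] at *
  intro x hx hx'
  simp only [Finset.mem_insert, Finset.mem_union, Finset.mem_erase, mem_discovered] at hx hx'
  rcases hx with rfl | hx
  · tauto
  · have := hDA hx
    tauto

lemma propConnected_closed_eq_univ {n : ℕ} {ω : Edge3Idx n → Bool} {D : Finset (Fin n)}
    {m : ℕ} {f : ℕ → Finset (Fin n)} (hedge : ∀ i < m, IsEdge3 ω (f i))
    (hcover : (Finset.range m).biUnion f = Finset.univ)
    (hstep : ∀ l, 1 ≤ l → l < m →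
      (f l ∩ (Finset.range l).biUnion f).card = (f l).card - 1)
    (hstart : 2 ≤ (f 0 ∩ D).card) (hclosed : ∀ e, IsEdge3 ω e → 2 ≤ (e ∩ D).card → e ⊆ D) :
    D = Finset.univ := by
  have key : ∀ l, l ≤ m → (Finset.range l).biUnion f ⊆ D := by
    intro l
    induction l with
    | zero => simp
    | succ l ih =>
      intro hl
      rw [Finset.range_add_one, Finset.biUnion_insert]
      refine Finset.union_subset (hclosed _ (hedge l hl) ?_) (ih (by omega))
      rcases Nat.eq_zero_or_pos l with rfl | hl0
      · exact hstart
      · have h3 := (hedge l hl).1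
        have h2 := hstep l hl0 hl
        have : (f l ∩ (Finset.range l).biUnion f).card ≤ (f l ∩ D).card :=
          Finset.card_le_card (Finset.inter_subset_inter_left (ih (by omega)))
        omega
  exact Finset.univ_subset_iff.1 (hcover ▸ key m le_rfl)

lemma survives_of_closed {n : ℕ} {ω : Edge3Idx n → Bool}
    {m : ℕ} {f : ℕ → Finset (Fin n)} (hedge : ∀ i < m, IsEdge3 ω (f i))
    (hcover : (Finset.range m).biUnion f = Finset.univ)
    (hstep : ∀ l, 1 ≤ l → l < m →
      (f l ∩ (Finset.range l).biUnion f).card = (f l).card - 1) (k : ℕ) :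
    ∀ D A : Finset (Fin n), Disjoint D A → D.card + k ≤ n → 2 ≤ (f 0 ∩ (D ∪ A)).card →
      (∀ e, IsEdge3 ω e → 2 ≤ (e ∩ D).card → e ⊆ D ∪ A) → Survives ω k D A := by
  induction k with
  | zero => intros; trivial
  | succ k ih =>
    intro D A hDA hcard hstart hclosed
    have hA : A.Nonempty := by
      by_contra hA
      rw [Finset.not_nonempty_iff_eq_empty] at hA
      subst hA
      rw [Finset.union_empty] at hstart hclosed
      have := propConnected_closed_eq_univ hedge hcover hstep hstart hclosed
      rw [this, Finset.card_univ, Fintype.card_fin] at hcard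
      omega
    have hv := A.min'_mem hA
    have hvD : A.min' hA ∉ D := fun h => Finset.disjoint_left.1 hDA h hv
    refine ⟨hA, ih _ _ (disjoint_step hv hDA) ?_ ?_ ?_⟩
    · rw [Finset.card_insert_of_notMem hvD]; omega
    · refine hstart.trans (Finset.card_le_card (Finset.inter_subset_inter_left ?_))
      intro x hx
      simp only [Finset.mem_union, Finset.mem_insert, Finset.mem_erase] at hx ⊢
      tauto
    · generalize A.min' hA = v at *
      intro e he h2
      have hmono : D ∪ A ⊆ insert v D ∪ (A.erase v ∪ discovered ω D A v) := by
        intro x hx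
        simp only [Finset.mem_union, Finset.mem_insert, Finset.mem_erase] at hx ⊢
        tauto
      by_cases hD : 2 ≤ (e ∩ D).card
      · exact (hclosed e he hD).trans hmono
      have hve : v ∈ e := by
        by_contra hve
        rw [Finset.inter_insert_of_notMem hve] at h2
        exact hD h2
      rw [Finset.inter_insert_of_mem hve, Finset.card_insert_of_notMem (by simp [hvD])] at h2
      obtain ⟨u, hu⟩ := Finset.card_pos.1 (by omega : 0 < (e ∩ D).card)
      rw [Finset.mem_inter] at hu
      have huv : u ≠ v := by rintro rfl; exact hvD hu.2
      intro w hw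
      by_cases hwDA : w ∈ D ∪ A
      · exact hmono hwDA
      have hw' : w ∉ D ∧ w ∉ A := by simpa using hwDA
      have hwv : w ≠ v := by rintro rfl; exact hw'.2 hv
      have hwu : w ≠ u := by rintro rfl; exact hw'.1 hu.2
      have heq : {u, v, w} = e := by
        refine Finset.eq_of_subset_of_card_le ?_ ?_
        · intro x hx
          simp only [Finset.mem_insert, Finset.mem_singleton] at hx
          rcases hx with rfl | rfl | rfl
          exacts [hu.1, hve, hw]
        · rw [he.1, Finset.card_eq_three.2 ⟨u, v, w, huv, hwu.symm, hwv.symm, rfl⟩]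
      simp only [Finset.mem_union, mem_discovered]
      exact Or.inr (Or.inr ⟨hw'.1, hw'.2, u, hu.2, heq ▸ he⟩)

lemma PropConnected3.exists_survives {n : ℕ} (hn : 1 ≤ n) {ω : Edge3Idx n → Bool}
    (h : PropConnected3 ω) : ∃ a b : Fin n, a ≠ b ∧ ∀ k, k + 1 ≤ n → Survives ω k {a} {b} := by
  obtain ⟨m, f, hedge, hcover, hstep⟩ := h
  have hm : 0 < m := by
    rcases Nat.eq_zero_or_pos m with rfl | hm
    · have : (⟨0, hn⟩ : Fin n) ∈ (Finset.range 0).biUnion f := hcover ▸ Finset.mem_univ _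
      simp at this
    · exact hm
  obtain ⟨a, b, c, hab, hac, hbc, habc⟩ := Finset.card_eq_three.1 (hedge 0 hm).1
  refine ⟨a, b, hab, fun k hk => survives_of_closed hedge hcover hstep k _ _ (by simpa)
    (by simp; omega) ?_ ?_⟩
  · have hsub : ({a, b} : Finset (Fin n)) ⊆ f 0 ∩ ({a} ∪ {b}) := by
      rw [habc]
      intro x hx
      simp at hx ⊢
      tauto
    exact (Finset.card_pair hab) ▸ Finset.card_le_card hsub
  · intro e _ h2
    have := h2.trans (Finset.card_le_card (Finset.inter_subset_right (s₁ := e) (s₂ := {a})))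
    simp at this

lemma dependsOn_discovered {n : ℕ} {D A : Finset (Fin n)} {v : Fin n} :
    DependsOn (fun ω : Edge3Idx n → Bool => discovered ω D A v)
      {e | ∃ u ∈ D, ∃ w, w ∉ D ∧ w ∉ A ∧ e.1 = {u, v, w}} := by
  intro ω ω' h
  ext w
  simp only [mem_discovered]
  refine and_congr_right fun hwD => and_congr_right fun hwA => exists_congr fun u =>
    and_congr_right fun hu => ?_
  exact exists_congr fun hc => by rw [h ⟨_, hc⟩ ⟨u, hu, w, hwD, hwA, rfl⟩]

lemma dependsOn_survives {n : ℕ} (k : ℕ) : ∀ D A : Finset (Fin n), Disjoint D A →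
    DependsOn (fun ω => Survives ω k D A) {e : Edge3Idx n | (e.1 ∩ D).card ≤ 1} := by
  induction k with
  | zero => intro D A _ ω ω' _; rfl
  | succ k ih =>
    intro D A hDA ω ω' h
    simp only [Survives]
    refine propext (exists_congr fun hA => ?_)
    have hv := A.min'_mem hA
    have hvD : A.min' hA ∉ D := fun h => Finset.disjoint_left.1 hDA h hv
    have hdisc : discovered ω D A (A.min' hA) = discovered ω' D A (A.min' hA) := by
      refine dependsOn_discovered fun e he => h e ?_
      obtain ⟨u, hu, w, hw, -, he⟩ := he
      rw [Set.mem_ofPred_eq, he, ← Finset.card_singleton u]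
      refine Finset.card_le_card ?_
      intro x hx
      simp only [Finset.mem_inter, Finset.mem_insert, Finset.mem_singleton] at hx ⊢
      rcases hx with ⟨rfl | rfl | rfl, hx⟩ <;> tauto
    rw [hdisc]
    refine iff_of_eq (ih _ _ (disjoint_step hv hDA) fun e he => h e ?_)
    exact (Finset.card_le_card (Finset.inter_subset_inter_left
      (Finset.subset_insert _ _))).trans he

/-- The edges that can be responsible for a discovery when `v` is processed. -/
noncomputable def discoveryEdges {n : ℕ} (D A : Finset (Fin n)) (v : Fin n) :
    Finset (Edge3Idx n) :=
  open scoped Classical in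
  Finset.univ.filter fun e => ∃ u ∈ D, ∃ w, w ∉ D ∧ w ∉ A ∧ e.1 = {u, v, w}

lemma mem_discoveryEdges {n : ℕ} {D A : Finset (Fin n)} {v : Fin n} {e : Edge3Idx n} :
    e ∈ discoveryEdges D A v ↔ ∃ u ∈ D, ∃ w, w ∉ D ∧ w ∉ A ∧ e.1 = {u, v, w} := by
  simp [discoveryEdges]

lemma card_discoveryEdges_le {n : ℕ} (D A : Finset (Fin n)) (v : Fin n) :
    (discoveryEdges D A v).card ≤ D.card * n := by
  calc (discoveryEdges D A v).card
      = ((discoveryEdges D A v).map (Function.Embedding.subtype _)).card :=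
        (Finset.card_map _).symm
    _ ≤ ((D ×ˢ Finset.univ).image fun x : Fin n × Fin n =>
          ({x.1, v, x.2} : Finset (Fin n))).card := by
        refine Finset.card_le_card fun e he => ?_
        obtain ⟨e', he', rfl⟩ := Finset.mem_map.1 he
        obtain ⟨u, hu, w, -, -, h⟩ := mem_discoveryEdges.1 he'
        exact Finset.mem_image.2 ⟨(u, w), by simp [hu], h.symm⟩
    _ ≤ (D ×ˢ (Finset.univ : Finset (Fin n))).card := Finset.card_image_le
    _ = D.card * n := by simp

lemma card_discovered_le {n : ℕ} (ω : Edge3Idx n → Bool) {D A : Finset (Fin n)} {v : Fin n}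
    (hv : v ∈ A) :
    (discovered ω D A v).card ≤ ((discoveryEdges D A v).filter fun e => ω e = true).card := by
  refine Finset.card_le_card_of_forall_subsingleton (fun w e => w ∈ e.1) ?_ ?_
  · intro w hw
    obtain ⟨hwD, hwA, u, hu, hc, he⟩ := mem_discovered.1 hw
    exact ⟨⟨_, hc⟩, Finset.mem_filter.2
      ⟨mem_discoveryEdges.2 ⟨u, hu, w, hwD, hwA, rfl⟩, he⟩, by simp⟩
  · intro e he
    obtain ⟨u, hu, w, -, -, he⟩ := mem_discoveryEdges.1 (Finset.mem_filter.1 he).1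
    have key : ∀ x, x ∈ discovered ω D A v ∧ x ∈ e.1 → x = w := by
      rintro x ⟨hx, hxe⟩
      obtain ⟨hxD, hxA, -⟩ := mem_discovered.1 hx
      rw [he, Finset.mem_insert, Finset.mem_insert, Finset.mem_singleton] at hxe
      rcases hxe with rfl | rfl | rfl
      exacts [absurd hu hxD, absurd hv hxA, rfl]
    exact fun x hx y hy => (key x hx).trans (key y hy).symm

lemma integral_prod_bern {ι : Type*} [Fintype ι] [DecidableEq ι] {p : ℝ} (hp0 : 0 ≤ p)
    (hp1 : p ≤ 1) (F : Finset ι) (y : ℝ) :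
    ∫ ω, y ^ (F.filter fun e => ω e = true).card ∂(Measure.pi fun _ : ι => bern p) =
      (1 + p * (y - 1)) ^ F.card := by
  have h : ∀ ω : ι → Bool, y ^ (F.filter fun e => ω e = true).card =
      ∏ i, if i ∈ F then (if ω i = true then y else 1) else 1 := by
    intro ω
    rw [Finset.prod_ite_mem, Finset.univ_inter, Finset.prod_ite]
    simp
  simp_rw [h]
  rw [integral_fintype_prod_eq_prod (𝕜 := ℝ) (fun i (b : Bool) =>
    if i ∈ F then (if b = true then y else 1) else 1)]
  calc _ = ∏ i, if i ∈ F then 1 + p * (y - 1) else 1 := by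
        refine Finset.prod_congr rfl fun i _ => ?_
        rw [integral_bern hp0 hp1]
        by_cases hi : i ∈ F
        · simp only [hi, if_true, Bool.false_eq_true, if_false]
          ring
        · simp only [hi, if_false]
          ring
    _ = _ := by rw [Finset.prod_ite_mem, Finset.univ_inter, Finset.prod_const]

lemma sum_real_fiber_mul {Ω α : Type*} [MeasurableSpace Ω] [Finite Ω]
    [DiscreteMeasurableSpace Ω] [Fintype α] (μ : Measure Ω) [IsFiniteMeasure μ]
    (X : Ω → α) (c : α → ℝ) :
    ∑ a, μ.real {ω | X ω = a} * c a = ∫ ω, c (X ω) ∂μ := by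
  classical
  have h : ∀ ω, c (X ω) = ∑ a, {ω | X ω = a}.indicator (fun _ => c a) ω := by
    intro ω
    simp [Set.indicator_apply]
  simp_rw [h]
  rw [integral_finsetSum _ fun _ _ => Integrable.of_finite]
  refine Finset.sum_congr rfl fun a _ => ?_
  rw [integral_indicator_const _ MeasurableSet.of_discrete, smul_eq_mul]

lemma expectation_discovered_le {n : ℕ} {p : ℝ} (hp0 : 0 ≤ p) (hp1 : p ≤ 1)
    {D A : Finset (Fin n)} {v : Fin n} (hv : v ∈ A) {y : ℝ} (hy : 1 ≤ y) :
    ∑ X, (Measure.pi fun _ : Edge3Idx n => bern p).real {ω | discovered ω D A v = X} *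
      y ^ X.card ≤ Real.exp (D.card * n * p * (y - 1)) := by
  have hpy : 0 ≤ p * (y - 1) := mul_nonneg hp0 (by linarith)
  calc _ = ∫ ω, y ^ (discovered ω D A v).card ∂(Measure.pi fun _ : Edge3Idx n => bern p) :=
        sum_real_fiber_mul _ (fun ω => discovered ω D A v) fun X => y ^ X.card
    _ ≤ ∫ ω, y ^ ((discoveryEdges D A v).filter fun e => ω e = true).card
          ∂(Measure.pi fun _ : Edge3Idx n => bern p) :=
        integral_mono Integrable.of_finite Integrable.of_finite fun ω =>
          pow_le_pow_right₀ hy (card_discovered_le ω hv)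
    _ = (1 + p * (y - 1)) ^ (discoveryEdges D A v).card := integral_prod_bern hp0 hp1 _ _
    _ ≤ (1 + p * (y - 1)) ^ (D.card * n) :=
        pow_le_pow_right₀ (by linarith) (card_discoveryEdges_le D A v)
    _ ≤ Real.exp (p * (y - 1)) ^ (D.card * n) := by
        gcongr
        linarith [Real.add_one_le_exp (p * (y - 1))]
    _ = _ := by
        rw [← Real.exp_nat_mul]
        push_cast
        ring_nf

lemma survives_succ_le {n : ℕ} {p : ℝ} (hp0 : 0 ≤ p) (hp1 : p ≤ 1) (k : ℕ)
    {D A : Finset (Fin n)} (hDA : Disjoint D A) (hA : A.Nonempty) :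
    (Measure.pi fun _ : Edge3Idx n => bern p).real {ω | Survives ω (k + 1) D A} ≤
      ∑ X, if Disjoint (insert (A.min' hA) D) (A.erase (A.min' hA) ∪ X) then
        (Measure.pi fun _ : Edge3Idx n => bern p).real
          {ω | discovered ω D A (A.min' hA) = X} *
        (Measure.pi fun _ : Edge3Idx n => bern p).real
          {ω | Survives ω k (insert (A.min' hA) D) (A.erase (A.min' hA) ∪ X)} else 0 := by
  classical
  have := bern_isProbabilityMeasure hp0 hp1
  have hv := A.min'_mem hA
  generalize hvdef : A.min' hA = v at *
  have hvD : v ∉ D := fun h => Finset.disjoint_left.1 hDA h hv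
  have hsub : {ω : Edge3Idx n → Bool | Survives ω (k + 1) D A} ⊆
      ⋃ X, {ω | discovered ω D A v = X ∧ Survives ω k (insert v D) (A.erase v ∪ X)} := by
    rintro ω ⟨hA', h⟩
    rw [hvdef] at h
    exact Set.mem_iUnion.2 ⟨_, rfl, h⟩
  refine (measureReal_mono hsub).trans ((measureReal_iUnion_fintype_le _).trans
    (Finset.sum_le_sum fun X _ => ?_))
  split_ifs with hdisj
  · refine (pi_real_inter_of_dependsOn (fun _ : Edge3Idx n => bern p)
      (Finset.univ.filter fun e => 2 ≤ (e.1 ∩ insert v D).card) ?_ ?_).le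
    · intro ω ω' h
      refine congrArg (· = X) (dependsOn_discovered fun e he => h e ?_)
      obtain ⟨u, hu, w, -, -, he⟩ := he
      have huv : u ≠ v := by rintro rfl; exact hvD hu
      rw [Finset.coe_filter_univ, Set.mem_ofPred_eq, he, ← Finset.card_pair huv]
      refine Finset.card_le_card fun x hx => ?_
      simp only [Finset.mem_inter, Finset.mem_insert, Finset.mem_singleton] at hx ⊢
      rcases hx with rfl | rfl <;> tauto
    · intro ω ω' h
      refine dependsOn_survives k _ _ hdisj fun e he => h e ?_
      rw [Set.mem_ofPred_eq] at he
      simp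
      omega
  · refine le_of_eq ?_
    convert measureReal_empty
    refine Set.eq_empty_of_forall_notMem ?_
    rintro ω ⟨rfl, -⟩
    exact hdisj (disjoint_step hv hDA)

lemma survives_le {n : ℕ} {p : ℝ} (hp0 : 0 ≤ p) (hp1 : p ≤ 1) {y : ℕ → ℝ}
    (hy : ∀ d, 1 ≤ d → 1 ≤ y d) (hanti : ∀ d, 1 ≤ d → y (d + 1) ≤ y d) (k : ℕ) :
    ∀ D A : Finset (Fin n), Disjoint D A → 1 ≤ D.card →
      (Measure.pi fun _ : Edge3Idx n => bern p).real {ω | Survives ω k D A} ≤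
        (∏ d ∈ Finset.Ico D.card (D.card + k), Real.exp (d * n * p * (y d - 1)) / y d) *
          y D.card ^ A.card := by
  have := bern_isProbabilityMeasure hp0 hp1
  have hprod : ∀ a b, 1 ≤ a →
      0 ≤ ∏ d ∈ Finset.Ico a b, Real.exp (d * n * p * (y d - 1)) / y d := by
    intro a b ha
    refine Finset.prod_nonneg fun d hd => div_nonneg (Real.exp_pos _).le ?_
    linarith [hy d (ha.trans (Finset.mem_Ico.1 hd).1)]
  induction k with
  | zero =>
    intro D A _ hD
    simpa using (measureReal_le_one).trans (one_le_pow₀ (hy _ hD))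
  | succ k ih =>
    intro D A hDA hD
    have hypos : 0 < y D.card := by linarith [hy _ hD]
    rcases A.eq_empty_or_nonempty with rfl | hA
    · have : {ω : Edge3Idx n → Bool | Survives ω (k + 1) D ∅} = ∅ :=
        Set.eq_empty_of_forall_notMem fun ω ⟨h, _⟩ => by simp at h
      rw [this, measureReal_empty]
      exact mul_nonneg (hprod _ _ hD) (by positivity)
    · refine (survives_succ_le hp0 hp1 k hDA hA).trans ?_
      have hv := A.min'_mem hA
      generalize A.min' hA = v at *
      have hvD : v ∉ D := fun h => Finset.disjoint_left.1 hDA h hv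
      obtain ⟨a, ha⟩ : ∃ a, A.card = a + 1 :=
        ⟨A.card - 1, by have := hA.card_pos; omega⟩
      have hcard : (insert v D).card = D.card + 1 := Finset.card_insert_of_notMem hvD
      set Q := ∏ d ∈ Finset.Ico (D.card + 1) (D.card + 1 + k),
        Real.exp (d * n * p * (y d - 1)) / y d with hQ
      have hQ0 : 0 ≤ Q := hprod _ _ (by omega)
      calc _ ≤ ∑ X, Q * y D.card ^ a * ((Measure.pi fun _ : Edge3Idx n => bern p).real
              {ω | discovered ω D A v = X} * y D.card ^ X.card) := by
            refine Finset.sum_le_sum fun X _ => ?_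
            split_ifs with hdisj
            · have h1 := ih _ _ hdisj (by omega)
              rw [hcard, ← hQ] at h1
              have h2 : (A.erase v ∪ X).card ≤ a + X.card := by
                refine (Finset.card_union_le _ _).trans ?_
                rw [Finset.card_erase_of_mem hv, ha, Nat.add_sub_cancel]
              have h3 : y (D.card + 1) ^ (A.erase v ∪ X).card ≤ y D.card ^ (a + X.card) :=
                (pow_le_pow_left₀ (by linarith [hy (D.card + 1) (by omega)])
                  (hanti _ hD) _).trans (pow_le_pow_right₀ (hy _ hD) h2)
              calc _ ≤ _ * (Q * y D.card ^ (a + X.card)) :=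
                    mul_le_mul_of_nonneg_left
                      (h1.trans (mul_le_mul_of_nonneg_left h3 hQ0)) measureReal_nonneg
                _ = _ := by ring
            · positivity
        _ ≤ Q * y D.card ^ a * Real.exp (D.card * n * p * (y D.card - 1)) := by
            rw [← Finset.mul_sum]
            exact mul_le_mul_of_nonneg_left
              (expectation_discovered_le hp0 hp1 hv (hy _ hD)) (by positivity)
        _ = _ := by
            rw [ha, Finset.prod_eq_prod_Ico_succ_bot (by omega : D.card < D.card + (k + 1)),
              show D.card + (k + 1) = D.card + 1 + k by ring, ← hQ, pow_succ]
            field_simp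

lemma propConnected_le {n : ℕ} (hn : 1 ≤ n) {p : ℝ} (hp0 : 0 ≤ p) (hp1 : p ≤ 1) {y : ℕ → ℝ}
    (hy : ∀ d, 1 ≤ d → 1 ≤ y d) (hanti : ∀ d, 1 ≤ d → y (d + 1) ≤ y d) {k : ℕ}
    (hk : k + 1 ≤ n) :
    (Measure.pi fun _ : Edge3Idx n => bern p).real {ω | PropConnected3 ω} ≤
      n ^ 2 * y 1 * ∏ d ∈ Finset.Ico 1 (1 + k), Real.exp (d * n * p * (y d - 1)) / y d := by
  classical
  have := bern_isProbabilityMeasure hp0 hp1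
  set B := (∏ d ∈ Finset.Ico 1 (1 + k), Real.exp (d * n * p * (y d - 1)) / y d) * y 1 with hB
  have hsub : {ω : Edge3Idx n → Bool | PropConnected3 ω} ⊆
      ⋃ x ∈ (Finset.univ : Finset (Fin n)).offDiag, {ω | Survives ω k {x.1} {x.2}} := by
    intro ω hω
    obtain ⟨a, b, hab, h⟩ := PropConnected3.exists_survives hn hω
    simp only [Set.mem_iUnion]
    exact ⟨(a, b), by simpa using hab, h k hk⟩
  have hB0 : 0 ≤ B := by
    refine mul_nonneg (Finset.prod_nonneg fun d hd => div_nonneg (Real.exp_pos _).le ?_) ?_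
    · linarith [hy d (Finset.mem_Ico.1 hd).1]
    · linarith [hy 1 le_rfl]
  calc _ ≤ ∑ x ∈ (Finset.univ : Finset (Fin n)).offDiag,
        (Measure.pi fun _ : Edge3Idx n => bern p).real {ω | Survives ω k {x.1} {x.2}} :=
        (measureReal_mono hsub (measure_ne_top _ _)).trans (measureReal_biUnion_finset_le _ _)
    _ ≤ ∑ x ∈ (Finset.univ : Finset (Fin n)).offDiag, B := by
        refine Finset.sum_le_sum fun x hx => ?_
        have := survives_le hp0 hp1 hy hanti k {x.1} {x.2} (by simpa using hx) (by simp)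
        simpa [hB] using this
    _ ≤ n ^ 2 * B := by
        rw [Finset.sum_const, nsmul_eq_mul]
        refine mul_le_mul_of_nonneg_right ?_ hB0
        rw [Finset.offDiag_card, Finset.card_univ, Fintype.card_fin, sq]
        exact_mod_cast Nat.sub_le _ _
    _ = _ := by rw [hB]; ring

lemma prod_mul_exp_le {L : ℝ} (hL : 0 < L) (k : ℕ) (hk : 1 ≤ k) :
    ∏ d ∈ Finset.Ico 1 (1 + k), ((d : ℝ) / L * Real.exp (1 - d / L)) ≤
      k * (k / L) ^ k * Real.exp (1 - k * (k + 1) / (2 * L)) := by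
  induction k, hk using Nat.le_induction with
  | base =>
    simp
    gcongr
    apply le_of_eq
    field_simp
    norm_num
  | succ k hk ih =>
    have hk0 : (0 : ℝ) < k + 1 := by positivity
    have hbase : (k : ℝ) / (k + 1) ≤ Real.exp (-(1 / (k + 1))) := by
      refine le_trans (le_of_eq ?_) (Real.add_one_le_exp _)
      field_simp
      ring
    have hpow : ((k : ℝ) / (k + 1)) ^ (k + 1) ≤ Real.exp (-1) := by
      refine (pow_le_pow_left₀ (by positivity) hbase _).trans (le_of_eq ?_)
      rw [← Real.exp_nat_mul]
      congr 1
      push_cast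
      field_simp
    have hstep : (k : ℝ) ^ (k + 1) ≤ Real.exp (-1) * (k + 1) ^ (k + 1) := by
      rwa [div_pow, div_le_iff₀ (by positivity)] at hpow
    rw [← add_assoc, Finset.prod_Ico_succ_top (by omega), add_comm 1 k]
    rw [add_comm 1 k] at ih
    push_cast
    calc _ ≤ k * (k / L) ^ k * Real.exp (1 - k * (k + 1) / (2 * L)) *
          ((k + 1) / L * Real.exp (1 - (k + 1) / L)) := by gcongr
      _ = (k : ℝ) ^ (k + 1) * ((k + 1) / L ^ (k + 1) *
          Real.exp (1 - k * (k + 1) / (2 * L) + (1 - (k + 1) / L))) := by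
          rw [Real.exp_add, div_pow]; field_simp; ring
      _ ≤ Real.exp (-1) * (k + 1) ^ (k + 1) * ((k + 1) / L ^ (k + 1) *
          Real.exp (1 - k * (k + 1) / (2 * L) + (1 - (k + 1) / L))) := by gcongr
      _ = (k + 1) * ((k + 1) / L) ^ (k + 1) * (Real.exp (-1) *
          Real.exp (1 - k * (k + 1) / (2 * L) + (1 - (k + 1) / L))) := by
          rw [div_pow]; ring
      _ = _ := by
          rw [← Real.exp_add]
          congr 2
          field_simp
          ring

lemma prod_mul_exp_floor_le {L : ℝ} (hL : 1 ≤ L) :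
    ∏ d ∈ Finset.Ico 1 (1 + ⌊L⌋₊), ((d : ℝ) / L * Real.exp (1 - d / L)) ≤
      L * Real.exp (3 / 2 - L / 2) := by
  have hL0 : 0 < L := by linarith
  have hfl : (⌊L⌋₊ : ℝ) ≤ L := Nat.floor_le hL0.le
  have hfl' : L < ⌊L⌋₊ + 1 := Nat.lt_floor_add_one L
  refine (prod_mul_exp_le hL0 _ (Nat.one_le_floor_iff _ |>.2 hL)).trans ?_
  have h1 : ((⌊L⌋₊ : ℝ) / L) ^ ⌊L⌋₊ ≤ 1 :=
    pow_le_one₀ (by positivity) ((div_le_one hL0).2 hfl)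
  refine mul_le_mul ((mul_le_mul hfl h1 (by positivity) hL0.le).trans (by simp)) ?_
    (Real.exp_pos _).le hL0.le
  rw [Real.exp_le_exp]
  have : (L - 1) / 2 ≤ ⌊L⌋₊ * (⌊L⌋₊ + 1) / (2 * L) := by
    rw [le_div_iff₀ (by positivity)]
    nlinarith
  linarith

lemma propConnected_le_log {n : ℕ} {r : ℝ} (hr0 : 0 < r) (hn : 1 < n)
    (hp1 : r / (n * Real.log n) ≤ 1) (hL : 1 ≤ Real.log n / r)
    (hLn : Real.log n / r + 1 ≤ n) :
    (hyp3Measure n r).real {ω | PropConnected3 ω} ≤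
      Real.exp (3 / 2) * ((Real.log n / r) ^ 2 *
        Real.exp (-((1 / 2 - 2 * r) * (Real.log n / r)))) := by
  have hn0 : (0 : ℝ) < n := by positivity
  have hlog : 0 < Real.log n := Real.log_pos (by exact_mod_cast hn)
  set L := Real.log n / r with hLdef
  have hL0 : 0 < L := by linarith
  have hnp : (n : ℝ) * (r / (n * Real.log n)) = 1 / L := by
    rw [hLdef]; field_simp
  have hk : ⌊L⌋₊ + 1 ≤ n := by
    have := Nat.floor_le hL0.le
    exact_mod_cast (by linarith : (⌊L⌋₊ : ℝ) + 1 ≤ n)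
  have hbound := propConnected_le hn.le (p := r / (n * Real.log n)) (by positivity) hp1
    (y := fun d => max 1 (L / d)) (fun d _ => le_max_left _ _)
    (fun d hd => by
      have : (0 : ℝ) < d := by exact_mod_cast hd
      gcongr
      simp) hk
  refine hbound.trans ?_
  have hprod : ∏ d ∈ Finset.Ico 1 (1 + ⌊L⌋₊),
      Real.exp (d * n * (r / (n * Real.log n)) * (max 1 (L / d) - 1)) / max 1 (L / d) =
      ∏ d ∈ Finset.Ico 1 (1 + ⌊L⌋₊), ((d : ℝ) / L * Real.exp (1 - d / L)) := by
    refine Finset.prod_congr rfl fun d hd => ?_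
    rw [Finset.mem_Ico] at hd
    have hd0 : (0 : ℝ) < d := by exact_mod_cast hd.1
    have hdL : (d : ℝ) ≤ L := (Nat.le_floor_iff hL0.le).1 (by omega)
    rw [max_eq_right ((one_le_div hd0).2 hdL), mul_assoc (d : ℝ), hnp]
    have : (d : ℝ) * (1 / L) * (L / d - 1) = 1 - d / L := by field_simp
    rw [this]
    field_simp
  have hexp : (n : ℝ) ^ 2 = Real.exp (2 * r * L) := by
    rw [show 2 * r * L = Real.log n + Real.log n by rw [hLdef]; field_simp; ring,
      Real.exp_add, Real.exp_log hn0, sq]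
  rw [hprod, Nat.cast_one, div_one, max_eq_right hL, hexp]
  refine (mul_le_mul_of_nonneg_left (prod_mul_exp_floor_le hL) (by positivity)).trans
    (le_of_eq ?_)
  have : Real.exp (2 * r * L) * Real.exp (3 / 2 - L / 2) =
      Real.exp (3 / 2) * Real.exp (-((1 / 2 - 2 * r) * L)) := by
    rw [← Real.exp_add, ← Real.exp_add]; ring_nf
  linear_combination L ^ 2 * this

/-- If `r < 1/4` then w.h.p. the random 3-uniform hypergraph `H(n, r/(n ln n))` is
not propagation connected. -/
theorem three_uniform_not_propagation_connected (r : ℝ) (hr0 : 0 < r)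
    (hr : r < 1 / 4) :
    Tendsto (fun n : ℕ => hyp3Measure n r {ω | PropConnected3 ω}) atTop (nhds 0) := by
  have hfin : ∀ n : ℕ, hyp3Measure n r {ω | PropConnected3 ω} ≠ ⊤ := fun n => by
    unfold hyp3Measure
    exact measure_ne_top _ _
  refine (ENNReal.tendsto_toReal_iff hfin ENNReal.zero_ne_top).1 ?_
  rw [ENNReal.toReal_zero]
  have hlog : Tendsto (fun n : ℕ => Real.log n) atTop atTop :=
    Real.tendsto_log_atTop.comp tendsto_natCast_atTop_atTop
  have hL : Tendsto (fun n : ℕ => Real.log n / r) atTop atTop := hlog.atTop_div_const hr0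
  have hlim : Tendsto (fun n : ℕ => Real.exp (3 / 2) * ((Real.log n / r) ^ 2 *
      Real.exp (-((1 / 2 - 2 * r) * (Real.log n / r))))) atTop (nhds 0) := by
    have hb : 0 < 1 / 2 - 2 * r := by linarith
    have h := (tendsto_rpow_mul_exp_neg_mul_atTop_nhds_zero 2 _ hb).comp hL
    simpa only [Function.comp_def, Real.rpow_two, neg_mul, mul_zero] using
      h.const_mul (Real.exp (3 / 2))
  have hsmall : ∀ᶠ n : ℕ in atTop, Real.log n / r + 1 ≤ n := by
    have h := (Real.isLittleO_log_id_atTop.comp_tendsto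
      (tendsto_natCast_atTop_atTop (R := ℝ))).bound (half_pos hr0)
    filter_upwards [h, eventually_ge_atTop 2] with n h hn
    have hn' : (2 : ℝ) ≤ n := by exact_mod_cast hn
    have h' := (le_abs_self _).trans h
    simp only [Function.comp_apply, id, Real.norm_eq_abs, Nat.abs_cast] at h'
    have : Real.log n / r ≤ n / 2 := by
      rw [div_le_iff₀ hr0]
      linarith
    linarith
  refine squeeze_zero' (Eventually.of_forall fun n => ENNReal.toReal_nonneg) ?_ hlim
  filter_upwards [hsmall, hL.eventually_ge_atTop 1, hlog.eventually_ge_atTop 1,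
    eventually_gt_atTop 1] with n h1 h2 h3 h4
  refine propConnected_le_log hr0 h4 ?_ h2 h1
  have hn' : (1 : ℝ) < n := by exact_mod_cast h4
  rw [div_le_one (by positivity)]
  nlinarith
end
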